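/- Let G be a primitive strongly regular graph with parameters (v,k,λ,μ) whose adjacency matrix (over ℝ) is A, and suppose 2(λ+μ) = 4k − v and 2k < v. Let B = J − I − 2A be the Seidel adjacency matrix of G and set ρ' = v − 2k − 1. Then A·(ρ'I − B) = (k − 2μ)·(ρ'I − B); that is, every column of ρ'I − B lies in the eigenspace of A for the eigenvalue θ₁ = k − 2μ (so that ρ'I − B is a positive scalar multiple of the primitive idempotent E₁ of the associated Bose–Mesner algebra). -/

import Mathlib

open Finset SimpleGraph Matrix

attribute [local instance] Classical.propDecidable

/-- The parameter identity `k (k - l - 1) = (v - k - 1) m` of a strongly regular graph with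
`2 (l + m) = 4 k - v` and `2 k < v`, rewritten as a factorisation over `ℝ`. -/
theorem SimpleGraph.IsSRGWith.two_mul_sub_eq_mul_sub {V : Type*} [Fintype V] {G : SimpleGraph V}
    [DecidableEq V] [DecidableRel G.Adj] {v k l m : ℕ} (h : G.IsSRGWith v k l m)
    (hcond : 2 * (l + m) + v = 4 * k) (hkv : 2 * k < v) :
    2 * ((k : ℝ) - m) = (k - 2 * m) * (v - 2 * k) := by
  have hp : k * (k - l - 1) = (v - k - 1) * m := IsSRGWith.param_eq G h (by omega)
  obtain ⟨a, rfl⟩ : ∃ a, k = l + 1 + a := ⟨k - l - 1, by omega⟩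
  obtain ⟨b, rfl⟩ : ∃ b, v = l + 1 + a + 1 + b := ⟨v - (l + 1 + a) - 1, by omega⟩
  rw [show l + 1 + a - l - 1 = a by omega,
    show l + 1 + a + 1 + b - (l + 1 + a) - 1 = b by omega] at hp
  have hp' : ((l : ℝ) + 1 + a) * a = b * m := mod_cast hp
  have hc : 2 * ((l : ℝ) + m) + (l + 1 + a + 1 + b) = 4 * (l + 1 + a) := mod_cast hcond
  push_cast
  linear_combination (-2) * hp' - ((l : ℝ) + 1 + a) * hc

/-- The square of the adjacency matrix of a strongly regular graph, in terms of `J`, `1`, `A`. -/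
theorem SimpleGraph.IsSRGWith.adjMatrix_mul_self {V : Type*} [Fintype V] {G : SimpleGraph V}
    [DecidableEq V] [DecidableRel G.Adj] {v k l m : ℕ} (h : G.IsSRGWith v k l m) :
    G.adjMatrix ℝ * G.adjMatrix ℝ = (k : ℝ) • (1 : Matrix V V ℝ) + (l : ℝ) • G.adjMatrix ℝ +
      (m : ℝ) • (Matrix.of (fun _ _ => (1 : ℝ)) - 1 - G.adjMatrix ℝ) := by
  rw [← pow_two, h.matrix_eq]
  ext i j
  simp only [Matrix.add_apply, Matrix.sub_apply, Matrix.smul_apply, Matrix.of_apply,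
    Matrix.one_apply, adjMatrix_apply, compl_adj]
  by_cases hij : i = j
  · subst hij
    simp
  · by_cases ha : G.Adj i j <;> simp [hij, ha]

theorem seidel_idempotent_eigen_pos
    {V : Type*} [Fintype V] [DecidableEq V] (G : SimpleGraph V)
    (v k l m : ℕ) (hsrg : G.IsSRGWith v k l m)
    (hprim : G.Connected ∧ Gᶜ.Connected)
    (hcond : 2 * (l + m) + v = 4 * k) (hkv : 2 * k < v) :
    G.adjMatrix ℝ *
        (((v : ℝ) - 2 * k - 1) • (1 : Matrix V V ℝ) -
          (Matrix.of (fun _ _ => (1 : ℝ)) - 1 - 2 • G.adjMatrix ℝ)) =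
      ((k : ℝ) - 2 * m) •
        (((v : ℝ) - 2 * k - 1) • (1 : Matrix V V ℝ) -
          (Matrix.of (fun _ _ => (1 : ℝ)) - 1 - 2 • G.adjMatrix ℝ)) := by
  have hJ : G.adjMatrix ℝ * Matrix.of (fun _ _ => (1 : ℝ)) =
      (k : ℝ) • Matrix.of (fun _ _ => (1 : ℝ)) := by
    ext i j
    simp [adjMatrix_mul_apply, hsrg.regular.degree_eq]
  have hp := hsrg.two_mul_sub_eq_mul_sub hcond hkv
  have hc : 2 * ((l : ℝ) + m) + v = 4 * k := mod_cast hcond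
  simp only [two_nsmul, mul_sub, mul_add, mul_smul_comm, mul_one, hJ, hsrg.adjMatrix_mul_self]
  ext i j
  simp only [Matrix.sub_apply, Matrix.add_apply, Matrix.smul_apply, Matrix.of_apply, smul_eq_mul]
  linear_combination (1 : Matrix V V ℝ) i j * hp + G.adjMatrix ℝ i j * hc
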